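/- arXiv:2112.06581 — 3 statements merged into one kernel-verified Lean document; each statement's English description precedes it below -/
import Mathlib

section
/- For all positive integers a and μ, the integer sequence n ↦ M(K_n; a) = Σ_{k=0}^{⌊n/2⌋} m_k(K_n) · a^k is ultimately periodic modulo μ. -/
open Finset

/-- A sequence of integers is ultimately periodic modulo `μ`. -/
def UltimatelyPeriodicMod (μ : ℕ) (f : ℕ → ℤ) : Prop :=
  ∃ N p : ℕ, 0 < p ∧ ∀ n : ℕ, N ≤ n → f (n + p) ≡ f n [ZMOD (μ : ℤ)]

/-- `matchK n k` is the number of matchings of size `k` in the complete graph on `Fin n`: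
sets of `k` pairwise (vertex-)disjoint edges. -/
def matchK (n k : ℕ) : ℕ :=
  (((⊤ : SimpleGraph (Fin n)).edgeFinset.powerset.filter
    (fun A => A.card = k ∧
      ∀ e ∈ A, ∀ f ∈ A, e ≠ f → ∀ v : Fin n, ¬(v ∈ e ∧ v ∈ f))).card)

/-- The generating matching polynomial of `K_n` evaluated at `a`:
`M(K_n; a) = Σ_{k=0}^{⌊n/2⌋} m_k(K_n) a^k`. -/
def matchPoly (n : ℕ) (a : ℤ) : ℤ :=
  ∑ k ∈ Finset.range (n / 2 + 1), (matchK n k : ℤ) * a ^ k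

/-- `IsMatchingIn S A` says that `A` is a set of pairwise disjoint non-loop edges with
endpoints in `S`. -/
def IsMatchingIn {α : Type*} (S : Finset α) (A : Finset (Sym2 α)) : Prop :=
  (∀ e ∈ A, ¬ e.IsDiag ∧ ∀ x ∈ e, x ∈ S) ∧
    ∀ e ∈ A, ∀ f ∈ A, e ≠ f → ∀ v : α, ¬(v ∈ e ∧ v ∈ f)

open Classical in
/-- The matchings of the complete graph on `S`. -/
noncomputable def matchingsIn {α : Type*} [Fintype α] (S : Finset α) :
    Finset (Finset (Sym2 α)) :=
  Finset.univ.filter (IsMatchingIn S)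

lemma mem_matchingsIn {α : Type*} [Fintype α] {S : Finset α} {A : Finset (Sym2 α)} :
    A ∈ matchingsIn S ↔ IsMatchingIn S A := by
  simp [matchingsIn]

lemma IsMatchingIn.mono {α : Type*} {S T : Finset α} {A : Finset (Sym2 α)}
    (h : IsMatchingIn S A) (hST : S ⊆ T) : IsMatchingIn T A :=
  ⟨fun e he => ⟨(h.1 e he).1, fun x hx => hST ((h.1 e he).2 x hx)⟩, h.2⟩

lemma IsMatchingIn.notMem_of_notMem {α : Type*} {S : Finset α} {A : Finset (Sym2 α)}
    (h : IsMatchingIn S A) {v w : α} (hv : v ∉ S) : s(v, w) ∉ A :=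
  fun he => hv ((h.1 _ he).2 v (Sym2.mem_mk_left v w))

lemma IsMatchingIn.two_mul_card_le {α : Type*} [DecidableEq α] {S : Finset α}
    {A : Finset (Sym2 α)} (h : IsMatchingIn S A) : 2 * A.card ≤ S.card := by
  have hcard : (A.biUnion Sym2.toFinset).card = ∑ e ∈ A, e.toFinset.card := by
    refine Finset.card_biUnion fun e he f hf hef => ?_
    simp only [Function.onFun]
    rw [Finset.disjoint_left]
    intro x hx hx'
    exact h.2 e he f hf hef x ⟨Sym2.mem_toFinset.1 hx, Sym2.mem_toFinset.1 hx'⟩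
  rw [Finset.sum_congr rfl fun e he => Sym2.card_toFinset_of_not_isDiag e (h.1 e he).1] at hcard
  have hsub : A.biUnion Sym2.toFinset ⊆ S := by
    refine Finset.biUnion_subset.2 fun e he x hx => ?_
    exact (h.1 e he).2 x (Sym2.mem_toFinset.1 hx)
  have := Finset.card_le_card hsub
  simp at hcard
  omega

lemma IsMatchingIn.insert_edge {α : Type*} [DecidableEq α] {S : Finset α} {v w : α}
    (hv : v ∉ S) (hw : w ∈ S) {B : Finset (Sym2 α)} (hB : IsMatchingIn (S.erase w) B) :
    IsMatchingIn (insert v S) (insert s(v, w) B) := by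
  have hvw : v ≠ w := fun h => hv (h ▸ hw)
  have key : ∀ e ∈ B, ∀ x : α, x ∈ s(v, w) → x ∉ e := by
    intro e he x hx hxe
    have := (hB.1 e he).2 x hxe
    rcases Sym2.mem_iff.1 hx with rfl | rfl
    · exact hv (Finset.mem_of_mem_erase this)
    · simp at this
  refine ⟨fun e he => ?_, fun e he f hf hef x hx => ?_⟩
  · rcases Finset.mem_insert.1 he with rfl | he
    · refine ⟨by simpa using hvw, fun x hx => ?_⟩
      rcases Sym2.mem_iff.1 hx with rfl | rfl <;> simp [hw]
    · exact ⟨(hB.1 e he).1, fun x hx =>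
        Finset.mem_insert_of_mem (Finset.mem_of_mem_erase ((hB.1 e he).2 x hx))⟩
  · rcases Finset.mem_insert.1 he with rfl | he <;> rcases Finset.mem_insert.1 hf with rfl | hf
    · exact hef rfl
    · exact key f hf x hx.1 hx.2
    · exact key e he x hx.2 hx.1
    · exact hB.2 e he f hf hef x hx

lemma IsMatchingIn.erase_edge {α : Type*} [DecidableEq α] {S : Finset α} {v w : α}
    {A : Finset (Sym2 α)} (hA : IsMatchingIn (insert v S) A) (he : s(v, w) ∈ A) :
    IsMatchingIn (S.erase w) (A.erase s(v, w)) := by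
  refine ⟨fun f hf => ⟨(hA.1 f (Finset.mem_of_mem_erase hf)).1, fun x hx => ?_⟩,
    fun f hf g hg => hA.2 f (Finset.mem_of_mem_erase hf) g (Finset.mem_of_mem_erase hg)⟩
  have hfA := Finset.mem_of_mem_erase hf
  have hne := hA.2 f hfA _ he (Finset.ne_of_mem_erase hf) x
  have hxS := (hA.1 f hfA).2 x hx
  simp only [Sym2.mem_iff, hx, true_and, not_or] at hne
  exact Finset.mem_erase.2 ⟨hne.2, (Finset.mem_insert.1 hxS).resolve_left hne.1⟩

lemma matchingsIn_insert {α : Type*} [Fintype α] [DecidableEq α] {S : Finset α} {v : α}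
    (hv : v ∉ S) :
    matchingsIn (insert v S) = matchingsIn S ∪
      S.biUnion fun w => (matchingsIn (S.erase w)).image (insert s(v, w)) := by
  ext A
  simp only [Finset.mem_union, Finset.mem_biUnion, Finset.mem_image, mem_matchingsIn]
  constructor
  · intro hA
    by_cases h : ∃ e ∈ A, v ∈ e
    · obtain ⟨e, he, hve⟩ := h
      obtain ⟨w, rfl⟩ := Sym2.mem_iff_exists.1 hve
      right
      have hdiag : v ≠ w := by simpa using (hA.1 _ he).1
      have hw := (hA.1 _ he).2 w (Sym2.mem_mk_right v w)
      exact ⟨w, (Finset.mem_insert.1 hw).resolve_left hdiag.symm, _, hA.erase_edge he,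
        Finset.insert_erase he⟩
    · left
      refine ⟨fun e he => ⟨(hA.1 e he).1, fun x hx => ?_⟩, hA.2⟩
      refine (Finset.mem_insert.1 ((hA.1 e he).2 x hx)).resolve_left ?_
      rintro rfl
      exact h ⟨e, he, hx⟩
  · rintro (hA | ⟨w, hw, B, hB, rfl⟩)
    · exact hA.mono (Finset.subset_insert v S)
    · exact hB.insert_edge hv hw

lemma sum_matchingsIn_insert {α R : Type*} [Fintype α] [DecidableEq α] [CommSemiring R] (a : R)
    {S : Finset α} {v : α} (hv : v ∉ S) :
    ∑ A ∈ matchingsIn (insert v S), a ^ A.card = ∑ A ∈ matchingsIn S, a ^ A.card +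
      ∑ w ∈ S, a * ∑ B ∈ matchingsIn (S.erase w), a ^ B.card := by
  have hnot : ∀ w u, ∀ B ∈ matchingsIn (S.erase w), s(v, u) ∉ B := fun w u B hB =>
    (mem_matchingsIn.1 hB).notMem_of_notMem fun h => hv (Finset.mem_of_mem_erase h)
  rw [matchingsIn_insert hv, Finset.sum_union, Finset.sum_biUnion]
  · congr 1
    refine Finset.sum_congr rfl fun w _ => ?_
    rw [Finset.sum_image, Finset.mul_sum]
    · refine Finset.sum_congr rfl fun B hB => ?_
      rw [Finset.card_insert_of_notMem (hnot w w B hB), pow_succ']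
    · intro B hB C hC hBC
      rw [← Finset.erase_insert (hnot w w B hB), hBC, Finset.erase_insert (hnot w w C hC)]
  · intro w _ u _ hwu
    simp only [Function.onFun]
    rw [Finset.disjoint_left]
    intro A hA hA'
    obtain ⟨B, hB, rfl⟩ := Finset.mem_image.1 hA
    obtain ⟨C, hC, hBC⟩ := Finset.mem_image.1 hA'
    have hmem : s(v, u) ∈ insert s(v, w) B := hBC ▸ Finset.mem_insert_self _ _
    rcases Finset.mem_insert.1 hmem with h | h
    · exact hwu (Sym2.congr_right.1 h).symm
    · exact hnot w u B hB h
  · rw [Finset.disjoint_left]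
    intro A hA hA'
    obtain ⟨w, _, hA'⟩ := Finset.mem_biUnion.1 hA'
    obtain ⟨B, _, rfl⟩ := Finset.mem_image.1 hA'
    exact (mem_matchingsIn.1 hA).notMem_of_notMem hv (Finset.mem_insert_self s(v, w) B)

/-- The sequence satisfying the recurrence of the matching polynomials of complete graphs. -/
def matchRec (a : ℤ) : ℕ → ℤ
  | 0 => 1
  | 1 => 1
  | n + 2 => matchRec a (n + 1) + (n + 1) * (a * matchRec a n)

lemma sum_matchingsIn_empty {α R : Type*} [Fintype α] [CommSemiring R] (a : R) :
    ∑ A ∈ matchingsIn (∅ : Finset α), a ^ A.card = 1 := by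
  have h : matchingsIn (∅ : Finset α) = {∅} := by
    ext A
    rw [mem_matchingsIn, Finset.mem_singleton]
    constructor
    · intro h
      refine Finset.eq_empty_of_forall_notMem fun e he => ?_
      induction e with
      | _ x y => simpa using (h.1 _ he).2 x (Sym2.mem_mk_left x y)
    · rintro rfl
      simp [IsMatchingIn]
  simp [h]

lemma sum_matchingsIn {α : Type*} [Fintype α] [DecidableEq α] (a : ℤ) :
    ∀ (n : ℕ) (S : Finset α), S.card = n →
      ∑ A ∈ matchingsIn S, a ^ A.card = matchRec a n := by
  intro n
  induction n using Nat.strong_induction_on with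
  | _ n ih =>
    intro S hS
    rcases S.eq_empty_or_nonempty with rfl | ⟨v, hv⟩
    · subst hS
      rw [sum_matchingsIn_empty]
      rfl
    · rw [← Finset.insert_erase hv, sum_matchingsIn_insert a (Finset.notMem_erase v S)]
      have hT : (S.erase v).card + 1 = n := by rw [Finset.card_erase_add_one hv, hS]
      generalize S.erase v = T at hT
      rw [ih T.card (by omega) T rfl]
      subst hT
      have hsum : ∀ w ∈ T, a * ∑ B ∈ matchingsIn (T.erase w), a ^ B.card =
          a * matchRec a (T.card - 1) := fun w hw => by
        rw [ih (T.card - 1) (by omega) _ (Finset.card_erase_of_mem hw)]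
      rw [Finset.sum_congr rfl hsum, Finset.sum_const, nsmul_eq_mul]
      rcases hc : T.card with _ | m
      · simp [matchRec]
      · simp [matchRec]

lemma matchPoly_eq_matchRec (n : ℕ) (a : ℤ) : matchPoly n a = matchRec a n := by
  rw [← sum_matchingsIn a n (Finset.univ : Finset (Fin n)) (by simp), matchPoly]
  rw [← Finset.sum_fiberwise_of_maps_to (t := Finset.range (n / 2 + 1))
    (g := Finset.card)]
  · refine Finset.sum_congr rfl fun k _ => ?_
    have hk : ∀ A ∈ (matchingsIn (Finset.univ : Finset (Fin n))).filter (fun A => A.card = k),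
        a ^ A.card = a ^ k := fun A hA => by rw [(Finset.mem_filter.1 hA).2]
    rw [Finset.sum_congr rfl hk, Finset.sum_const, nsmul_eq_mul, matchK]
    congr 3
    ext A
    simp only [Finset.mem_filter, Finset.mem_powerset, mem_matchingsIn, IsMatchingIn,
      Finset.subset_iff, SimpleGraph.mem_edgeFinset, SimpleGraph.edgeSet_top]
    simp
    tauto
  · intro A hA
    have := (mem_matchingsIn.1 hA).two_mul_card_le
    simp at this ⊢
    omega

/-- The orbit of a self-map of a finite type is ultimately periodic. -/
lemma exists_ultimate_period_of_finite {β : Type*} [Finite β] (s : ℕ → β) (F : β → β)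
    (hs : ∀ n, s (n + 1) = F (s n)) :
    ∃ N p : ℕ, 0 < p ∧ ∀ n, N ≤ n → s (n + p) = s n := by
  obtain ⟨i, j, hij, h⟩ : ∃ i j, i < j ∧ s i = s j := by
    obtain ⟨i, j, hne, h⟩ := Finite.exists_ne_map_eq_of_infinite s
    rcases lt_or_gt_of_ne hne with hlt | hlt
    · exact ⟨i, j, hlt, h⟩
    · exact ⟨j, i, hlt, h.symm⟩
  refine ⟨i, j - i, by omega, fun n hn => ?_⟩
  induction n, hn using Nat.le_induction with
  | base => rw [Nat.add_sub_cancel' hij.le, h]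
  | succ n _ ih => rw [Nat.add_right_comm, hs, ih, hs]

theorem matchPoly_ultimately_periodic_mod
    (a : ℤ) (ha : 0 < a) (μ : ℕ) (hμ : 0 < μ) :
    UltimatelyPeriodicMod μ (fun n => matchPoly n a) := by
  have : NeZero μ := ⟨hμ.ne'⟩
  obtain ⟨N, p, hp, h⟩ := exists_ultimate_period_of_finite
    (fun n => ((n : ZMod μ), (matchRec a n : ZMod μ), (matchRec a (n + 1) : ZMod μ)))
    (fun x => (x.1 + 1, x.2.2, x.2.2 + (x.1 + 1) * (a * x.2.1)))
    (fun n => by simp [matchRec])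
  refine ⟨N, p, hp, fun n hn => ?_⟩
  simp only [matchPoly_eq_matchRec]
  rw [← ZMod.intCast_eq_intCast_iff]
  exact congrArg (fun x => x.2.1) (h n hn)
end

section
/- For all positive integers a, b, c, μ, the integer sequence n ↦ C(K_n; a, b, c) is ultimately periodic modulo μ. -/
open Finset

/-- `kappa n A` is the number of connected components of the spanning subgraph of
the complete graph on `Fin n` with edge set `A`. -/
noncomputable def kappa (n : ℕ) (A : Finset (Sym2 (Fin n))) : ℕ :=
  Nat.card (SimpleGraph.fromEdgeSet (↑A : Set (Sym2 (Fin n)))).ConnectedComponent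

/-- `covComp n A` is the number of connected components of the spanning subgraph of
the complete graph on `Fin n` with edge set `A` that contain at least one edge. -/
noncomputable def covComp (n : ℕ) (A : Finset (Sym2 (Fin n))) : ℕ :=
  Nat.card {C : (SimpleGraph.fromEdgeSet (↑A : Set (Sym2 (Fin n)))).ConnectedComponent //
    ∃ v w : Fin n, (SimpleGraph.fromEdgeSet (↑A : Set (Sym2 (Fin n)))).Adj v w ∧
      (SimpleGraph.fromEdgeSet (↑A : Set (Sym2 (Fin n)))).connectedComponentMk v = C}

/-- The covered components polynomial of `K_n` evaluated at `(x, y, z)`: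
`C(K_n; x, y, z) = Σ_{A ⊆ E(K_n)} x^κ(A) y^|A| z^c(A)`. -/
noncomputable def coveredCompK (n : ℕ) (x y z : ℤ) : ℤ :=
  ∑ A ∈ (⊤ : SimpleGraph (Fin n)).edgeFinset.powerset,
    x ^ kappa n A * y ^ A.card * z ^ covComp n A

/-- The transfer operator adding one vertex of colour `k`: it contributes the current multiplier
`t k`, and the multiplier of `k` is then scaled by `q k`. -/
def colourTransfer {K R : Type*} [Fintype K] [DecidableEq K] [CommRing R] (q : K → R)
    (W : (K → R) → R) : (K → R) → R :=
  fun t => ∑ k, t k * W (Function.update t k (t k * q k))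

lemma iterate_colourTransfer_one {K R : Type*} [Fintype K] [DecidableEq K] [CommRing R]
    (q : K → R) (n : ℕ) (t : K → R) :
    (colourTransfer q)^[n] 1 t =
      ∑ f : Fin n → K, ∏ k, t k ^ #{v | f v = k} * q k ^ (#{v | f v = k}).choose 2 := by
  induction n generalizing t with
  | zero => simp
  | succ n ih =>
    rw [Function.iterate_succ_apply', ← (Fin.consEquiv fun _ => K).sum_comp,
      Fintype.sum_prod_type]
    simp only [colourTransfer]
    refine Finset.sum_congr rfl fun k _ => ?_
    rw [ih, Finset.mul_sum]
    refine Finset.sum_congr rfl fun f _ => ?_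
    have hcard : ∀ j, #{v | (Fin.consEquiv fun _ : Fin (n + 1) => K) (k, f) v = j} =
        (if k = j then 1 else 0) + #{v | f v = j} := by
      intro j
      rw [Finset.card_filter, Finset.card_filter, Fin.sum_univ_succ]
      simp [Fin.consEquiv]
    simp only [hcard]
    rw [← Finset.mul_prod_erase _ _ (Finset.mem_univ k),
      ← Finset.mul_prod_erase univ
        (fun j => t j ^ ((if k = j then 1 else 0) + #{v | f v = j}) *
          q j ^ ((if k = j then 1 else 0) + #{v | f v = j}).choose 2) (Finset.mem_univ k),
      ← mul_assoc]
    congr 1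
    · have : (1 + #{v | f v = k}).choose 2 = #{v | f v = k} + (#{v | f v = k}).choose 2 := by
        rw [add_comm, Nat.choose_succ_succ' _ 1, Nat.choose_one_right]
      simp only [Function.update_self, if_true, this]
      ring
    · refine Finset.prod_congr rfl fun j hj => ?_
      have hjk : j ≠ k := Finset.ne_of_mem_erase hj
      simp [Function.update_of_ne hjk, hjk.symm]

lemma exists_iterate_add_eq {α : Type*} [Finite α] (F : α → α) (x : α) :
    ∃ N p : ℕ, 0 < p ∧ ∀ n, N ≤ n → F^[n + p] x = F^[n] x := by
  obtain ⟨i, j, hij, h⟩ := Finite.exists_ne_map_eq_of_infinite fun n => F^[n] x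
  wlog hlt : i < j generalizing i j
  · exact this j i hij.symm h.symm (by omega)
  refine ⟨i, j - i, by omega, fun n hn => ?_⟩
  obtain ⟨k, rfl⟩ := Nat.exists_eq_add_of_le' hn
  have h1 : k + i + (j - i) = k + j := by omega
  rw [h1, Function.iterate_add_apply, Function.iterate_add_apply F k i]
  exact congrArg _ h.symm

open Classical in
/-- Colour the components of `G` with `m` colours, where components without edges may also stay
uncoloured at a cost of `d`. -/
lemma sum_colourings_eq_prod_components {V R : Type*} [Fintype V] [DecidableEq V] [CommRing R]
    (G : SimpleGraph V) (m : ℕ) (d : R) :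
    (∑ f : V → Option (Fin m),
      if ∀ u v, G.Adj u v → ∃ i, f u = some i ∧ f v = some i then d ^ #{v | f v = none} else 0) =
    ∏ C : G.ConnectedComponent,
      if ∃ v w, G.Adj v w ∧ G.connectedComponentMk v = C then (m : R) else d + m := by
  let φ : G.ConnectedComponent → Option (Fin m) → R := fun C o =>
    if o = none then (if ∃ v w, G.Adj v w ∧ G.connectedComponentMk v = C then 0 else d) else 1
  have hφ : ∀ C, (if ∃ v w, G.Adj v w ∧ G.connectedComponentMk v = C then (m : R) else d + m) =
      ∑ o, φ C o := by
    intro C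
    rw [Fintype.sum_option]
    by_cases h : ∃ v w, G.Adj v w ∧ G.connectedComponentMk v = C
    · simp only [φ, if_pos h]
      simp
    · simp only [φ, if_neg h]
      simp
  simp only [hφ]
  rw [Finset.prod_univ_sum, Fintype.piFinset_univ]
  symm
  refine Finset.sum_of_injOn (fun g v => g (G.connectedComponentMk v)) ?_ (by simp) ?_ ?_
  · intro g _ g' _ h
    funext C
    induction C using SimpleGraph.ConnectedComponent.ind with
    | h v => exact congrFun h v
  · intro f _ hf
    refine if_neg fun hc => hf ?_
    have hr : ∀ u v, G.Reachable u v → f u = f v := by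
      rintro u v ⟨p⟩
      induction p with
      | nil => rfl
      | cons h _ ih =>
        obtain ⟨i, h1, h2⟩ := hc _ _ h
        rw [← ih, h1, h2]
    exact ⟨fun C => C.lift f fun u v p _ => hr u v ⟨p⟩, by simp, by funext v; rfl⟩
  · intro g _
    split_ifs with hc
    · have hnone : ∀ C, g C = none → ¬ ∃ v w, G.Adj v w ∧ G.connectedComponentMk v = C := by
        rintro _ hC ⟨v, w, hvw, rfl⟩
        obtain ⟨i, hi, -⟩ := hc v w hvw
        simp [hC] at hi
      have hprod : ∀ C, φ C (g C) = if g C = none then d else 1 := by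
        intro C
        by_cases hC : g C = none
        · simp only [φ, if_pos hC, if_neg (hnone C hC)]
        · simp only [φ, if_neg hC]
      simp only [hprod]
      rw [Finset.prod_ite, Finset.prod_const, Finset.prod_const_one, mul_one]
      congr 1
      symm
      refine Finset.card_bij (fun v _ => G.connectedComponentMk v) (by simp) ?_ ?_
      · intro u hu v hv huv
        simp only [Finset.mem_filter, Finset.mem_univ, true_and] at hu
        obtain ⟨p⟩ := SimpleGraph.ConnectedComponent.exact huv
        cases p with
        | nil => rfl
        | cons h _ => exact (hnone _ hu ⟨_, _, h, rfl⟩).elim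
      · intro C hC
        induction C using SimpleGraph.ConnectedComponent.ind with
        | h v => exact ⟨v, by simpa using hC, rfl⟩
    · push Not at hc
      obtain ⟨u, v, huv, h⟩ := hc
      refine Finset.prod_eq_zero (Finset.mem_univ (G.connectedComponentMk u)) ?_
      have hg : g (G.connectedComponentMk u) = none := by
        cases hi : g (G.connectedComponentMk u) with
        | none => rfl
        | some i =>
          refine (h i hi ?_).elim
          rw [← SimpleGraph.ConnectedComponent.sound huv.reachable, hi]
      simp only [φ, if_pos hg]
      exact if_pos ⟨u, v, huv, rfl⟩

open Classical in
lemma pow_kappa_mul_pow_covComp (n : ℕ) (A : Finset (Sym2 (Fin n))) (x z : ℤ) :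
    x ^ kappa n A * z ^ covComp n A =
      ∏ C : (SimpleGraph.fromEdgeSet (↑A : Set (Sym2 (Fin n)))).ConnectedComponent,
        if ∃ v w, (SimpleGraph.fromEdgeSet (↑A : Set (Sym2 (Fin n)))).Adj v w ∧
          (SimpleGraph.fromEdgeSet (↑A : Set (Sym2 (Fin n)))).connectedComponentMk v = C
        then x * z else x := by
  have h : ∀ (P : Prop) [Decidable P], (if P then x * z else x) = x * if P then z else 1 := by
    intro P _
    split_ifs <;> simp
  simp only [h]
  rw [Finset.prod_mul_distrib, Finset.prod_ite, Finset.prod_const, Finset.prod_const,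
    Finset.prod_const_one, mul_one, kappa, covComp, Nat.card_eq_fintype_card,
    Nat.card_eq_fintype_card, Fintype.card_subtype, Finset.card_univ]

/-- The edges whose two ends have the same colour. -/
def monoEdges {V K : Type*} [Fintype V] [DecidableEq V] [Fintype K] [DecidableEq K]
    (f : V → Option K) : Finset (Sym2 V) :=
  univ.biUnion fun i : K => (univ.filter fun v => f v = some i).offDiag.image Sym2.mk.uncurry

lemma mk_mem_monoEdges {V K : Type*} [Fintype V] [DecidableEq V] [Fintype K] [DecidableEq K]
    (f : V → Option K) (u v : V) :
    s(u, v) ∈ monoEdges f ↔ u ≠ v ∧ ∃ i, f u = some i ∧ f v = some i := by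
  simp only [monoEdges, mem_biUnion, mem_univ, true_and, mem_image, mem_offDiag, mem_filter,
    Prod.exists]
  constructor
  · rintro ⟨i, a, b, ⟨ha, hb, hab⟩, h⟩
    rcases Sym2.eq_iff.1 h with ⟨rfl, rfl⟩ | ⟨rfl, rfl⟩
    · exact ⟨hab, i, ha, hb⟩
    · exact ⟨hab.symm, i, hb, ha⟩
  · rintro ⟨hab, i, ha, hb⟩
    exact ⟨i, u, v, ⟨ha, hb, hab⟩, rfl⟩

lemma card_monoEdges {V K : Type*} [Fintype V] [DecidableEq V] [Fintype K] [DecidableEq K]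
    (f : V → Option K) :
    #(monoEdges f) = ∑ i : K, (#{v | f v = some i}).choose 2 := by
  rw [monoEdges, Finset.card_biUnion]
  · exact Finset.sum_congr rfl fun i _ => Sym2.card_image_offDiag _
  · intro i _ j _ hij
    rw [Function.onFun, Finset.disjoint_left]
    intro e
    induction e with
    | h u v =>
      simp only [mem_image, mem_offDiag, mem_filter, mem_univ, true_and, Prod.exists]
      rintro ⟨a, b, ⟨ha, hb, -⟩, h⟩ ⟨a', b', ⟨ha', hb', -⟩, h'⟩
      rcases Sym2.eq_iff.1 (h.trans h'.symm) with ⟨rfl, rfl⟩ | ⟨rfl, rfl⟩ <;>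
        simp_all

lemma subset_monoEdges_iff {n : ℕ} {K : Type*} [Fintype K] [DecidableEq K]
    (f : Fin n → Option K) {A : Finset (Sym2 (Fin n))}
    (hA : A ⊆ (⊤ : SimpleGraph (Fin n)).edgeFinset) :
    A ⊆ monoEdges f ↔
      ∀ u v, (SimpleGraph.fromEdgeSet (↑A : Set (Sym2 (Fin n)))).Adj u v →
        ∃ i, f u = some i ∧ f v = some i := by
  constructor
  · intro h u v huv
    rw [SimpleGraph.fromEdgeSet_adj] at huv
    exact ((mk_mem_monoEdges f u v).1 (h (by simpa using huv.1))).2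
  · intro h e he
    induction e with
    | h u v =>
      have huv : u ≠ v := by simpa using hA he
      exact (mk_mem_monoEdges f u v).2 ⟨huv, h u v (by simpa using ⟨he, huv⟩)⟩

lemma coveredCompK_eq_sum_colourings (n m : ℕ) (x y z : ℤ) (hm : (m : ℤ) = x * z) :
    coveredCompK n x y z =
      ∑ f : Fin n → Option (Fin m),
        (x - m) ^ #{v | f v = none} * (1 + y) ^ #(monoEdges f) := by
  classical
  have hterm : ∀ A ∈ (⊤ : SimpleGraph (Fin n)).edgeFinset.powerset,
      x ^ kappa n A * y ^ #A * z ^ covComp n A =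
        ∑ f : Fin n → Option (Fin m),
          if A ⊆ monoEdges f then (x - m) ^ #{v | f v = none} * y ^ #A else 0 := by
    intro A hA
    rw [mul_right_comm]
    have h := sum_colourings_eq_prod_components
      (SimpleGraph.fromEdgeSet (↑A : Set (Sym2 (Fin n)))) m (x - m : ℤ)
    rw [sub_add_cancel, hm] at h
    have h' : x ^ kappa n A * z ^ covComp n A = _ :=
      (pow_kappa_mul_pow_covComp n A x z).trans (by convert h.symm)
    rw [h', Finset.sum_mul]
    refine Finset.sum_congr rfl fun f _ => ?_
    simp only [subset_monoEdges_iff f (Finset.mem_powerset.1 hA), ite_mul, zero_mul, hm]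
  rw [coveredCompK, Finset.sum_congr rfl hterm, Finset.sum_comm]
  refine Finset.sum_congr rfl fun f _ => ?_
  have hsub : monoEdges f ⊆ (⊤ : SimpleGraph (Fin n)).edgeFinset := by
    intro e
    induction e with
    | h u v => intro he; simpa using ((mk_mem_monoEdges f u v).1 he).1
  have hfilter : (⊤ : SimpleGraph (Fin n)).edgeFinset.powerset.filter (· ⊆ monoEdges f) =
      (monoEdges f).powerset := by
    ext A
    simp only [mem_filter, mem_powerset]
    exact ⟨fun h => h.2, fun h => ⟨h.trans hsub, h⟩⟩
  rw [← Finset.sum_filter, hfilter, ← Finset.mul_sum, add_comm 1 y,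
    ← Finset.sum_pow_mul_eq_add_pow]
  simp

lemma coveredCompK_cast_eq_iterate {R : Type*} [CommRing R] (n m : ℕ) (x y z : ℤ)
    (hm : (m : ℤ) = x * z) :
    ((coveredCompK n x y z : ℤ) : R) =
      (colourTransfer fun o : Option (Fin m) => o.elim (1 : R) fun _ => 1 + (y : R))^[n] 1
        (fun o => o.elim ((x : R) - m) fun _ => 1) := by
  rw [coveredCompK_eq_sum_colourings n m x y z hm, iterate_colourTransfer_one]
  push_cast
  refine Finset.sum_congr rfl fun f _ => ?_
  rw [Fintype.prod_option, card_monoEdges]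
  simp [Finset.prod_pow_eq_pow_sum]

theorem coveredCompK_ultimately_periodic_mod
    (a b c : ℤ) (ha : 0 < a) (hb : 0 < b) (hc : 0 < c) (μ : ℕ) (hμ : 0 < μ) :
    UltimatelyPeriodicMod μ (fun n => coveredCompK n a b c) := by
  have : NeZero μ := ⟨hμ.ne'⟩
  obtain ⟨m, hm⟩ := Int.eq_ofNat_of_zero_le (mul_pos ha hc).le
  obtain ⟨N, p, hp, h⟩ := exists_iterate_add_eq
    (colourTransfer fun o : Option (Fin m) => o.elim (1 : ZMod μ) fun _ => 1 + (b : ZMod μ)) 1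
  refine ⟨N, p, hp, fun n hn => ?_⟩
  rw [← ZMod.intCast_eq_intCast_iff]
  simp only [coveredCompK_cast_eq_iterate _ m a b c hm.symm, h n hn]
end

section
/- Let a, b, c, μ be positive integers such that ab divides c. Then for every n the rational number ξ(K_n; a, b, c) is an integer, and the integer sequence n ↦ ξ(K_n; a, b, c) is ultimately periodic modulo μ. -/
open Finset

/-- The edge elimination polynomial of `K_n` evaluated at rationals `(x, y, z)`:
`ξ(K_n; x, y, z) = Σ_{(A,B) disjoint, A,B ⊆ E(K_n)}
  x^(κ(A∪B) - c(B)) y^(|A|+|B| - c(B)) z^(c(B))` (integer exponents). -/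
noncomputable def xiK (n : ℕ) (x y z : ℚ) : ℚ :=
  ∑ A ∈ (⊤ : SimpleGraph (Fin n)).edgeFinset.powerset,
    ∑ B ∈ (⊤ : SimpleGraph (Fin n)).edgeFinset.powerset.filter (fun B => Disjoint A B),
      x ^ ((kappa n (A ∪ B) : ℤ) - (covComp n B : ℤ)) *
        y ^ ((A.card : ℤ) + (B.card : ℤ) - (covComp n B : ℤ)) *
        z ^ ((covComp n B : ℤ))

/-- The partition function of the vertex-weighted, edge-weighted colourings of `K_n` with colours
in `C`, where `ν` weighs the colours and `w` weighs the pairs of colours along the edges. -/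
def partitionFunction {C R : Type*} [Fintype C] [CommSemiring R] (w : Sym2 C → R) (n : ℕ)
    (ν : C → R) : R :=
  ∑ φ : Fin n → C, (∏ v, ν (φ v)) *
    ∏ e ∈ (⊤ : SimpleGraph (Fin n)).edgeFinset, w (e.map φ)

theorem prod_edgeFinset_top {M : Type*} [CommMonoid M] (n : ℕ) (W : Sym2 (Fin n) → M) :
    ∏ e ∈ (⊤ : SimpleGraph (Fin n)).edgeFinset, W e =
      ∏ i, ∏ j, if i < j then W s(i, j) else 1 := by
  have h : (⊤ : SimpleGraph (Fin n)).edgeFinset =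
      (univ : Finset (Fin n)).sym2.filter (fun e => ¬ e.IsDiag) := by
    ext e
    induction e with | _ u v => simp
  have hsym : ∏ e ∈ (univ : Finset (Fin n)).sym2 with ¬ e.IsDiag, W e =
      ∏ i ∈ (univ : Finset (Fin n)).offDiag with i.1 < i.2, W s(i.1, i.2) :=
    Finset.sum_sym2_filter_not_isDiag (M := Additive M) univ fun e => Additive.ofMul (W e)
  rw [h, hsym, ← Finset.prod_product', Finset.prod_ite,
    Finset.prod_const_one, mul_one]
  refine Finset.prod_congr ?_ fun _ _ => rfl
  ext ⟨i, j⟩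
  simp only [mem_filter, mem_offDiag, mem_univ, true_and, mem_product, and_true]
  exact ⟨fun h => h.2, fun h => ⟨h.ne, h⟩⟩

theorem prod_edgeFinset_top_succ {M : Type*} [CommMonoid M] (n : ℕ)
    (W : Sym2 (Fin (n + 1)) → M) :
    ∏ e ∈ (⊤ : SimpleGraph (Fin (n + 1))).edgeFinset, W e =
      (∏ j : Fin n, W s(0, j.succ)) *
        ∏ e ∈ (⊤ : SimpleGraph (Fin n)).edgeFinset, W (e.map Fin.succ) := by
  rw [prod_edgeFinset_top, prod_edgeFinset_top]
  simp [Fin.prod_univ_succ]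

theorem partitionFunction_zero {C R : Type*} [Fintype C] [CommSemiring R] (w : Sym2 C → R)
    (ν : C → R) : partitionFunction w 0 ν = 1 := by
  simp only [partitionFunction, prod_edgeFinset_top]
  simp

/-- Colouring the first vertex with `i` multiplies the weight of a colour `j` at every other vertex
by `w s(i, j)`. -/
theorem partitionFunction_succ {C R : Type*} [Fintype C] [CommSemiring R] (w : Sym2 C → R)
    (n : ℕ) (ν : C → R) :
    partitionFunction w (n + 1) ν =
      ∑ i, ν i * partitionFunction w n (fun j => ν j * w s(i, j)) := by
  unfold partitionFunction
  rw [← (Fin.consEquiv fun _ => C).sum_comp, Fintype.sum_prod_type]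
  refine Finset.sum_congr rfl fun i _ => ?_
  rw [Finset.mul_sum]
  refine Finset.sum_congr rfl fun φ _ => ?_
  rw [prod_edgeFinset_top_succ, Fin.prod_univ_succ]
  have hmap (e : Sym2 (Fin n)) :
      Sym2.map (Fin.cons i φ : Fin (n + 1) → C) (e.map Fin.succ) = e.map φ := by
    rw [Sym2.map_map]
    rfl
  simp only [Fin.consEquiv, Equiv.coe_fn_mk, Fin.cons_zero, Fin.cons_succ, Sym2.map_mk, hmap,
    Finset.prod_mul_distrib]
  ring

theorem map_partitionFunction {C R S : Type*} [Fintype C] [CommSemiring R] [CommSemiring S]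
    (F : R →+* S) (w : Sym2 C → R) (n : ℕ) (ν : C → R) :
    F (partitionFunction w n ν) = partitionFunction (fun e => F (w e)) n (fun i => F (ν i)) := by
  simp [partitionFunction]

theorem partitionFunction_eq_iterate {C R : Type*} [Fintype C] [CommSemiring R] (w : Sym2 C → R)
    (n : ℕ) :
    partitionFunction w n =
      (fun (Z : (C → R) → R) ν => ∑ i, ν i * Z (fun j => ν j * w s(i, j)))^[n] fun _ => 1 := by
  induction n with
  | zero => exact funext (partitionFunction_zero w)
  | succ n ih =>
    rw [Function.iterate_succ_apply', ← ih]
    exact funext (partitionFunction_succ w n)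

theorem exists_iterate_add_eq_of_finite {α : Type*} [Finite α] (T : α → α) (x : α) :
    ∃ N p : ℕ, 0 < p ∧ ∀ n, N ≤ n → T^[n + p] x = T^[n] x := by
  obtain ⟨i, j, hij, h⟩ : ∃ i j, i < j ∧ T^[i] x = T^[j] x := by
    obtain ⟨i, j, hne, h⟩ := Finite.exists_ne_map_eq_of_infinite fun n : ℕ => T^[n] x
    rcases hne.lt_or_gt with hlt | hlt
    exacts [⟨i, j, hlt, h⟩, ⟨j, i, hlt, h.symm⟩]
  refine ⟨i, j - i, Nat.sub_pos_of_lt hij, fun n hn => ?_⟩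
  rw [show n + (j - i) = (n - i) + j by omega, Function.iterate_add_apply, ← h,
    ← Function.iterate_add_apply, Nat.sub_add_cancel hn]

theorem ultimatelyPeriodicMod_partitionFunction {C : Type*} [Fintype C] {μ : ℕ} (hμ : 0 < μ)
    (w : Sym2 C → ℤ) (ν : C → ℤ) :
    UltimatelyPeriodicMod μ fun n => partitionFunction w n ν := by
  have : NeZero μ := ⟨hμ.ne'⟩
  obtain ⟨N, p, hp, h⟩ := exists_iterate_add_eq_of_finite
    (fun (Z : (C → ZMod μ) → ZMod μ) ν => ∑ i, ν i * Z (fun j => ν j * (w s(i, j) : ZMod μ)))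
    fun _ => 1
  refine ⟨N, p, hp, fun n hn => ?_⟩
  rw [← ZMod.intCast_eq_intCast_iff]
  have hmap (m : ℕ) := map_partitionFunction (Int.castRingHom (ZMod μ)) w m ν
  simp only [eq_intCast] at hmap
  rw [hmap, hmap, partitionFunction_eq_iterate, partitionFunction_eq_iterate, h n hn]

/-- Maps that are constant along the edges of `G` are maps on the connected components. -/
theorem SimpleGraph.sum_connectedComponent {V X R : Type*} [Fintype V] [DecidableEq V] [Fintype X]
    [AddCommMonoid R] (G : SimpleGraph V) [Fintype G.ConnectedComponent]
    [DecidableEq G.ConnectedComponent] (F : (V → X) → R)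
    (hF : ∀ g, (¬ ∀ u v, G.Adj u v → g u = g v) → F g = 0) :
    ∑ k : G.ConnectedComponent → X, F (fun v => k (G.connectedComponentMk v)) = ∑ g, F g := by
  classical
  refine Finset.sum_of_injOn (fun k v => k (G.connectedComponentMk v)) ?_ (by simp) ?_
    fun _ _ => rfl
  · intro k _ k' _ h
    ext C
    induction C using SimpleGraph.ConnectedComponent.ind with
    | _ v => exact congrFun h v
  · intro g _ hg
    refine hF g fun hadj => hg ?_
    have hwalk (u v : V) (p : G.Walk u v) : g u = g v := by
      induction p with
      | nil => rfl
      | cons h _ ih => exact (hadj _ _ h).trans ih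
    exact ⟨SimpleGraph.ConnectedComponent.lift g fun u v p _ => hwalk u v p, by simp, rfl⟩

theorem sum_disjoint_prod_mul_prod {α R : Type*} [DecidableEq α] [CommSemiring R] (E : Finset α)
    (x y : α → R) :
    ∑ A ∈ E.powerset, (∏ e ∈ A, x e) *
      ∑ B ∈ E.powerset.filter (fun B => Disjoint A B), ∏ e ∈ B, y e = ∏ e ∈ E, (1 + x e + y e) := by
  have h (e : α) : 1 + x e + y e = x e + (1 + y e) := by ring
  simp_rw [h]
  rw [Finset.prod_add]
  refine Finset.sum_congr rfl fun A _ => ?_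
  rw [Finset.prod_one_add]
  congr 1
  refine Finset.sum_congr ?_ fun _ _ => rfl
  ext B
  simp only [mem_filter, mem_powerset, Finset.subset_sdiff, disjoint_comm]

/-- The weight of an optional colour: `none` is only meant for isolated vertices. -/
def optionWeight (d : ℕ) (o : Option (Fin d)) : ℤ := if o = none then 1 - d else 1

theorem pow_kappa (n a : ℕ) (A : Finset (Sym2 (Fin n))) :
    (a : ℤ) ^ kappa n A =
      ∑ h : Fin n → Fin a, ∏ e ∈ A, if (e.map h).IsDiag then 1 else 0 := by
  classical
  let G := SimpleGraph.fromEdgeSet (A : Set (Sym2 (Fin n)))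
  have hG (h : Fin n → Fin a) : (∀ e ∈ A, (e.map h).IsDiag) ↔ ∀ u v, G.Adj u v → h u = h v := by
    constructor
    · intro H u v huv
      simpa using H _ ((SimpleGraph.fromEdgeSet_adj _).1 huv).1
    · intro H e he
      induction e with
      | _ u v =>
        by_cases huv : u = v
        · simp [huv]
        · simpa using H u v ((SimpleGraph.fromEdgeSet_adj _).2 ⟨he, huv⟩)
  have key := G.sum_connectedComponent (X := Fin a)
    (fun h => ∏ e ∈ A, if (e.map h).IsDiag then (1 : ℤ) else 0)
    (fun h hh => by
      rw [Finset.prod_ite_zero, if_neg (by rwa [hG])])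
  rw [← key, Finset.sum_congr rfl fun k _ => by
    rw [Finset.prod_ite_zero, if_pos ((hG _).2 fun u v huv => by
      rw [SimpleGraph.ConnectedComponent.connectedComponentMk_eq_of_adj huv])]]
  simp [kappa, G, Nat.card_eq_fintype_card]

theorem pow_covComp (n d : ℕ) (B : Finset (Sym2 (Fin n)))
    (hB : B ⊆ (⊤ : SimpleGraph (Fin n)).edgeFinset) :
    (d : ℤ) ^ covComp n B =
      ∑ g : Fin n → Option (Fin d), (∏ v, optionWeight d (g v)) *
        ∏ e ∈ B, if ∃ x, e.map g = Sym2.diag (some x) then 1 else 0 := by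
  classical
  let G := SimpleGraph.fromEdgeSet (B : Set (Sym2 (Fin n)))
  have hadj (u v : Fin n) : G.Adj u v ↔ s(u, v) ∈ B := by
    refine ⟨fun h => ((SimpleGraph.fromEdgeSet_adj _).1 h).1,
      fun h => (SimpleGraph.fromEdgeSet_adj _).2 ⟨h, ?_⟩⟩
    simpa using hB h
  have hvalid (g : Fin n → Option (Fin d)) :
      (∀ e ∈ B, ∃ x, e.map g = Sym2.diag (some x)) ↔
        ∀ u v, G.Adj u v → g u = g v ∧ g u ≠ none := by
    constructor
    · intro H u v huv
      obtain ⟨x, hx⟩ := H _ ((hadj u v).1 huv)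
      have : g u = some x ∧ g v = some x := by simpa [Sym2.diag] using hx
      simp [this]
    · intro H e he
      induction e with
      | _ u v =>
        obtain ⟨h1, h2⟩ := H u v ((hadj u v).2 he)
        obtain ⟨x, hx⟩ := Option.ne_none_iff_exists'.1 h2
        exact ⟨x, by simp [Sym2.diag, ← h1, hx]⟩
  let θ (v : Fin n) (o : Option (Fin d)) : ℤ :=
    if o = none then (if ∃ u, G.Adj v u then 0 else 1 - d) else 1
  have hθ (u v : Fin n) (o : Option (Fin d)) (ho : o = none) (huv : G.Adj u v) : θ u o = 0 := by
    have : ∃ u', G.Adj u u' := ⟨v, huv⟩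
    simp [θ, ho, this]
  rw [← G.sum_connectedComponent _ fun g hg => by
    rw [Finset.prod_ite_zero, if_neg fun h => hg fun u v huv => (((hvalid g).1 h) u v huv).1,
      mul_zero]]
  have hterm (k : G.ConnectedComponent → Option (Fin d)) :
      ((∏ v, optionWeight d (k (G.connectedComponentMk v))) *
        ∏ e ∈ B, if ∃ x, e.map (fun v => k (G.connectedComponentMk v)) = Sym2.diag (some x)
          then 1 else 0) =
      ∏ C, ∏ v with G.connectedComponentMk v = C, θ v (k C) := by
    have hfib : ∏ C, ∏ v with G.connectedComponentMk v = C, θ v (k C) =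
        ∏ v, θ v (k (G.connectedComponentMk v)) := by
      rw [← Finset.prod_fiberwise univ G.connectedComponentMk]
      refine Finset.prod_congr rfl fun C _ => Finset.prod_congr rfl fun v hv => ?_
      rw [(mem_filter.1 hv).2]
    rw [hfib, Finset.prod_ite_zero, Finset.prod_const_one, mul_ite, mul_one, mul_zero]
    split_ifs with h
    · rw [hvalid] at h
      refine Finset.prod_congr rfl fun v _ => ?_
      by_cases hv : ∃ u, G.Adj v u
      · obtain ⟨u, hu⟩ := hv
        simp [optionWeight, θ, (h v u hu).2]
      · simp [optionWeight, θ, hv]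
    · rw [hvalid] at h
      push Not at h
      obtain ⟨u, v, huv, h⟩ := h
      have := h (by rw [SimpleGraph.ConnectedComponent.connectedComponentMk_eq_of_adj huv])
      exact (Finset.prod_eq_zero (mem_univ u)
        (hθ u v _ this huv)).symm
  have hcomp (C : G.ConnectedComponent) :
      ∑ o, ∏ v with G.connectedComponentMk v = C, θ v o =
        if ∃ v w, G.Adj v w ∧ G.connectedComponentMk v = C then (d : ℤ) else 1 := by
    have hsome : ∑ x : Fin d, ∏ v with G.connectedComponentMk v = C, θ v (some x) = d := by
      simp [θ]
    rw [Fintype.sum_option, hsome]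
    split_ifs with h
    · obtain ⟨v, w, hvw, hC⟩ := h
      rw [Finset.prod_eq_zero (i := v) (by simp [hC]) (hθ v w _ rfl hvw), zero_add]
    · push Not at h
      induction C using SimpleGraph.ConnectedComponent.ind with
      | _ v =>
        have hiso (u : Fin n) : ¬ G.Adj v u := fun hu => h v u hu rfl
        have hsing : (univ.filter fun u => G.connectedComponentMk u = G.connectedComponentMk v) =
            {v} := by
          ext u
          simp only [mem_filter, mem_univ, true_and, mem_singleton]
          refine ⟨fun hu => ?_, fun hu => by rw [hu]⟩
          obtain ⟨p⟩ := SimpleGraph.ConnectedComponent.exact hu.symm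
          cases p with
          | nil => rfl
          | cons h' _ => exact absurd h' (hiso _)
        rw [hsing, Finset.prod_singleton]
        simp [θ, hiso]
  rw [Finset.sum_congr rfl fun k _ => hterm k,
    ← Fintype.prod_sum fun C o => ∏ v with G.connectedComponentMk v = C, θ v o,
    Finset.prod_congr rfl fun C _ => hcomp C, Finset.prod_ite, Finset.prod_const,
    Finset.prod_const_one, mul_one, covComp, Nat.card_eq_fintype_card, Fintype.card_subtype]

/-- The edge weight in the partition function that computes `ξ(K_n; a, b, abd)`. -/
noncomputable def xiWeight (a b d : ℕ) (e : Sym2 (Fin a × Option (Fin d))) : ℤ :=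
  open Classical in
  1 + b * (if (e.map Prod.fst).IsDiag then 1 else 0) +
    b * (if (e.map Prod.fst).IsDiag then 1 else 0) *
      (if ∃ x, e.map Prod.snd = Sym2.diag (some x) then 1 else 0)

theorem sum_eq_partitionFunction (n a b d : ℕ) :
    ∑ A ∈ (⊤ : SimpleGraph (Fin n)).edgeFinset.powerset,
      ∑ B ∈ (⊤ : SimpleGraph (Fin n)).edgeFinset.powerset.filter (fun B => Disjoint A B),
        (a : ℤ) ^ kappa n (A ∪ B) * (b : ℤ) ^ (#A + #B) * (d : ℤ) ^ covComp n B =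
      partitionFunction (xiWeight a b d) n (fun i => optionWeight d i.2) := by
  classical
  let x (h : Fin n → Fin a) (e : Sym2 (Fin n)) : ℤ := if (e.map h).IsDiag then 1 else 0
  let y (g : Fin n → Option (Fin d)) (e : Sym2 (Fin n)) : ℤ :=
    if ∃ x, e.map g = Sym2.diag (some x) then 1 else 0
  have hterm (A B : Finset (Sym2 (Fin n))) (hB : B ⊆ (⊤ : SimpleGraph (Fin n)).edgeFinset)
      (hAB : Disjoint A B) :
      (a : ℤ) ^ kappa n (A ∪ B) * (b : ℤ) ^ (#A + #B) * (d : ℤ) ^ covComp n B =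
        ∑ h : Fin n → Fin a, ∑ g : Fin n → Option (Fin d), (∏ v, optionWeight d (g v)) *
          ((∏ e ∈ A, b * x h e) * ∏ e ∈ B, b * x h e * y g e) := by
    rw [pow_kappa, pow_covComp n d B hB, Finset.sum_mul, Finset.sum_mul]
    refine Finset.sum_congr rfl fun h _ => ?_
    rw [Finset.mul_sum]
    refine Finset.sum_congr rfl fun g _ => ?_
    rw [Finset.prod_union hAB]
    simp only [Finset.prod_mul_distrib, Finset.prod_const, pow_add, x, y]
    ring
  rw [Finset.sum_congr rfl fun A _ => Finset.sum_congr rfl fun B hB =>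
    hterm A B (mem_powerset.1 (mem_filter.1 hB).1) (mem_filter.1 hB).2]
  simp_rw [Finset.sum_comm (s := Finset.filter _ _) (t := (univ : Finset (Fin n → Fin a))),
    Finset.sum_comm (s := Finset.filter _ _) (t := (univ : Finset (Fin n → Option (Fin d))))]
  rw [Finset.sum_comm]
  simp_rw [Finset.sum_comm (s := Finset.powerset _)
    (t := (univ : Finset (Fin n → Option (Fin d)))), ← Finset.mul_sum]
  simp_rw [sum_disjoint_prod_mul_prod]
  rw [← Fintype.sum_prod_type', partitionFunction,
    ← (Equiv.arrowProdEquivProdArrow (Fin n) (fun _ => Fin a)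
      (fun _ => Option (Fin d))).symm.sum_comp]
  refine Finset.sum_congr rfl fun p _ => ?_
  simp only [xiWeight, Sym2.map_map, x, y]
  rfl

theorem xiK_eq_partitionFunction (n a b d : ℕ) (ha : 0 < a) (hb : 0 < b) :
    ((partitionFunction (xiWeight a b d) n (fun i => optionWeight d i.2) : ℤ) : ℚ) =
      xiK n a b ((a * b * d : ℕ) : ℚ) := by
  have ha' : (a : ℚ) ≠ 0 := by positivity
  have hb' : (b : ℚ) ≠ 0 := by positivity
  rw [← sum_eq_partitionFunction, xiK]
  push_cast
  refine Finset.sum_congr rfl fun A _ => Finset.sum_congr (by congr) fun B _ => ?_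
  rw [zpow_sub₀ ha', zpow_sub₀ hb', ← Nat.cast_add]
  simp only [zpow_natCast, mul_pow]
  field_simp

theorem xiK_integer_and_ultimately_periodic_mod
    (a b c μ : ℕ) (ha : 0 < a) (hb : 0 < b) (hc : 0 < c) (hμ : 0 < μ)
    (hdvd : a * b ∣ c) :
    ∃ f : ℕ → ℤ, (∀ n : ℕ, (f n : ℚ) = xiK n (a : ℚ) (b : ℚ) (c : ℚ)) ∧
      UltimatelyPeriodicMod μ f := by
  obtain ⟨d, rfl⟩ := hdvd
  exact ⟨_, fun n => xiK_eq_partitionFunction n a b d ha hb,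
    ultimatelyPeriodicMod_partitionFunction hμ _ _⟩
end
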